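/- Let F : [0,∞) × ℝ → ℝ be continuous, let y be a solution of (*) on [0,a), let 0 < c < a, and let h > 0. Put x_k = k·h for k ∈ ℕ. Then there exist reals ε_k for all k with x_{k+1} ≤ c such that: (i) |ε_k| ≤ sup{ |y′(s) − y′(t)| : s, t ∈ [0,c], |s − t| ≤ h }, and (ii) the Euler recursion y₀ = 0, y_{k+1} = y_k + (F(x_k, y_k) + ε_k)·h satisfies y_k = y(x_k) for every k with x_k ≤ c. -/

import Mathlib

/-- `y` is a solution of the initial value problem (*): `y 0 = 0`, `y' x = F (x, y x)`,
on the interval `[0, a)` where `0 < a ≤ ∞` (one-sided derivative at `0`). -/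
def IsSolutionOn (F : ℝ × ℝ → ℝ) (a : EReal) (y : ℝ → ℝ) : Prop :=
  0 < a ∧ y 0 = 0 ∧
    ∀ x : ℝ, 0 ≤ x → (x : EReal) < a →
      HasDerivWithinAt y (F (x, y x)) {t : ℝ | 0 ≤ t ∧ (t : EReal) < a} x

/-- A solution of (*) on `[0, a)` is global (noncontinuable) if it is not the
restriction of a solution on any `[0, a')` with `a' > a`. -/
def IsGlobalSolutionOn (F : ℝ × ℝ → ℝ) (a : EReal) (y : ℝ → ℝ) : Prop :=
  IsSolutionOn F a y ∧
    ¬ ∃ (a' : EReal) (z : ℝ → ℝ), a < a' ∧ IsSolutionOn F a' z ∧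
        ∀ x : ℝ, 0 ≤ x → (x : EReal) < a → z x = y x

namespace IsSolutionOn

variable {F : ℝ × ℝ → ℝ} {a : EReal} {y : ℝ → ℝ} {c : ℝ}

theorem hasDerivWithinAt_Icc (hy : IsSolutionOn F a y) (hca : (c : EReal) < a) {x : ℝ}
    (hx : x ∈ Set.Icc 0 c) : HasDerivWithinAt y (F (x, y x)) (Set.Icc 0 c) x :=
  (hy.2.2 x hx.1 ((EReal.coe_le_coe_iff.2 hx.2).trans_lt hca)).mono fun _ ht =>
    ⟨ht.1, (EReal.coe_le_coe_iff.2 ht.2).trans_lt hca⟩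

theorem continuousOn_Icc (hy : IsSolutionOn F a y) (hca : (c : EReal) < a) :
    ContinuousOn y (Set.Icc 0 c) := fun _ hx =>
  (hy.hasDerivWithinAt_Icc hca hx).continuousWithinAt

/-- The derivative of a solution is bounded on compact subintervals, so the set whose supremum
is its modulus of continuity is bounded above. -/
theorem bddAbove_oscillation (hy : IsSolutionOn F a y) (hca : (c : EReal) < a)
    (hF : ContinuousOn F (Set.Ici (0 : ℝ) ×ˢ (Set.univ : Set ℝ))) (h : ℝ) :
    BddAbove {v : ℝ | ∃ s ∈ Set.Icc (0 : ℝ) c, ∃ t ∈ Set.Icc (0 : ℝ) c,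
      |s - t| ≤ h ∧ v = |F (s, y s) - F (t, y t)|} := by
  have hcont : ContinuousOn (fun x => F (x, y x)) (Set.Icc 0 c) :=
    hF.comp (continuousOn_id.prodMk (hy.continuousOn_Icc hca)) fun _ hx => ⟨hx.1, trivial⟩
  obtain ⟨M, hM⟩ := isCompact_Icc.exists_bound_of_continuousOn hcont
  refine ⟨M + M, ?_⟩
  rintro _ ⟨s, hs, t, ht, -, rfl⟩
  exact (abs_sub _ _).trans (add_le_add (hM s hs) (hM t ht))

/-- Mean value theorem for a solution of the initial value problem. -/
theorem exists_slope_eq (hy : IsSolutionOn F a y) (hca : (c : EReal) < a) {u v : ℝ}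
    (hu : 0 ≤ u) (huv : u < v) (hv : v ≤ c) :
    ∃ t ∈ Set.Ioo u v, F (t, y t) = (y v - y u) / (v - u) := by
  refine exists_hasDerivAt_eq_slope y (fun x => F (x, y x)) huv
    ((hy.continuousOn_Icc hca).mono (Set.Icc_subset_Icc hu hv)) fun x hx => ?_
  have hx0 : 0 < x := hu.trans_lt hx.1
  have hxc : x < c := hx.2.trans_le hv
  exact (hy.hasDerivWithinAt_Icc hca ⟨hx0.le, hxc.le⟩).hasDerivAt (Icc_mem_nhds hx0 hxc)

end IsSolutionOn

/-- **Every solution is reproduced by a perturbed Euler scheme** (classical content of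
Lemma 5.1). Let `y` be a solution of (*) on `[0, a)`, `0 < c < a`, `h > 0`, and
`x k = k·h`. Then there are perturbations `εs k` (for `k` with `x (k+1) ≤ c`) bounded
by the oscillation `sup {|y' s - y' t| : s, t ∈ [0,c], |s - t| ≤ h}` of the derivative
`y' = F (·, y ·)`, such that the Euler recursion `Y 0 = 0`,
`Y (k+1) = Y k + (F (x k, Y k) + εs k)·h` satisfies `Y k = y (x k)` whenever
`x k ≤ c`. -/
theorem solution_is_perturbed_euler (F : ℝ × ℝ → ℝ)
    (hF : ContinuousOn F (Set.Ici (0 : ℝ) ×ˢ (Set.univ : Set ℝ)))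
    (a : EReal) (y : ℝ → ℝ) (hy : IsSolutionOn F a y)
    (c : ℝ) (hc : 0 < c) (hca : (c : EReal) < a) (h : ℝ) (hh : 0 < h) :
    ∃ εs : ℕ → ℝ, ∃ Y : ℕ → ℝ, Y 0 = 0 ∧
      (∀ k : ℕ, ((k + 1 : ℕ) : ℝ) * h ≤ c →
        |εs k| ≤ sSup {v : ℝ | ∃ s ∈ Set.Icc (0 : ℝ) c, ∃ t ∈ Set.Icc (0 : ℝ) c,
          |s - t| ≤ h ∧ v = |F (s, y s) - F (t, y t)|}) ∧
      (∀ k : ℕ, ((k + 1 : ℕ) : ℝ) * h ≤ c →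
        Y (k + 1) = Y k + (F ((k : ℝ) * h, Y k) + εs k) * h) ∧
      (∀ k : ℕ, ((k : ℕ) : ℝ) * h ≤ c → Y k = y ((k : ℝ) * h)) := by
  refine ⟨fun k => (y (((k + 1 : ℕ) : ℝ) * h) - y ((k : ℝ) * h)) / h
    - F ((k : ℝ) * h, y ((k : ℝ) * h)), fun k => y ((k : ℝ) * h), ?_, fun k hk => ?_,
    fun k _ => ?_, fun _ _ => rfl⟩
  · simpa using hy.2.1
  · have hstep : ((k + 1 : ℕ) : ℝ) * h = (k : ℝ) * h + h := by push_cast; ring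
    have hk0 : 0 ≤ (k : ℝ) * h := by positivity
    obtain ⟨t, ht, hslope⟩ := hy.exists_slope_eq hca hk0 (by linarith) hk
    have hdiff : ((k + 1 : ℕ) : ℝ) * h - (k : ℝ) * h = h := by linarith
    rw [hdiff] at hslope
    simp only [← hslope]
    refine le_csSup (hy.bddAbove_oscillation hca hF h)
      ⟨t, ⟨hk0.trans ht.1.le, ht.2.le.trans hk⟩, (k : ℝ) * h, ⟨hk0, by linarith⟩, ?_, rfl⟩
    rw [abs_of_pos (sub_pos.2 ht.1)]
    linarith [ht.2]
  · field_simp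
    ring
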